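/- Let U be a seed transformation with blocks as above, let 𝔰 ⊆ F_2^{2m} be the row space of Σ_M, and let 𝔰₀ = Σ_{i≥0} 𝔰 μ_M^i be the smallest μ_M-invariant subspace of F_2^{2m} containing 𝔰. Then for every M′ ∈ 𝔰₀^⊥ there exists a unique M ∈ 𝔰₀^⊥ such that there exist L ∈ F_2^{2k} and S ∈ F_2^{n−k} with (M:L:S) U_eff = (0_{2n} : M′), i.e., such that there is an edge of physical weight 0 from M to M′ in the state diagram. -/

import Mathlib

open Matrix

/-- The 2N×2N binary matrix Λ_N, block diagonal with N copies of [[0,1],[1,0]]. -/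
def lambdaMat (N : ℕ) : Matrix (Fin (2 * N)) (Fin (2 * N)) (ZMod 2) :=
  Matrix.of fun i j => if i.val / 2 = j.val / 2 ∧ i ≠ j then 1 else 0

/-- The symplectic product P ⋆ Q = P Λ_N Qᵀ of row vectors P, Q ∈ F_2^{2N}. -/
def sstar {N : ℕ} (P Q : Fin (2 * N) → ZMod 2) : ZMod 2 :=
  Matrix.vecMul P (lambdaMat N) ⬝ᵥ Q

/-- A 2N×2N binary matrix is symplectic if U Λ_N Uᵀ = Λ_N.  A seed transformation of a
quantum convolutional encoder with parameters (n,k,m) is a symplectic 2(n+m)×2(n+m) matrix. -/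
def IsSymplectic {N : ℕ} (U : Matrix (Fin (2 * N)) (Fin (2 * N)) (ZMod 2)) : Prop :=
  U * lambdaMat N * Uᵀ = lambdaMat N


/-- The block μ_P of a seed transformation: rows 1..2m, first 2n columns. -/
def muP (n m : ℕ) (U : Matrix (Fin (2 * (n + m))) (Fin (2 * (n + m))) (ZMod 2)) :
    Matrix (Fin (2 * m)) (Fin (2 * n)) (ZMod 2) :=
  Matrix.of fun i j =>
    U ⟨i.val, by have := i.isLt; omega⟩ ⟨j.val, by have := j.isLt; omega⟩

/-- The block μ_M of a seed transformation: rows 1..2m, last 2m columns. -/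
def muM (n m : ℕ) (U : Matrix (Fin (2 * (n + m))) (Fin (2 * (n + m))) (ZMod 2)) :
    Matrix (Fin (2 * m)) (Fin (2 * m)) (ZMod 2) :=
  Matrix.of fun i j =>
    U ⟨i.val, by have := i.isLt; omega⟩ ⟨2 * n + j.val, by have := j.isLt; omega⟩

/-- The block Λ_P of a seed transformation: rows 2m+1..2m+2k, first 2n columns. -/
def lamP (n k m : ℕ) (hk : k ≤ n)
    (U : Matrix (Fin (2 * (n + m))) (Fin (2 * (n + m))) (ZMod 2)) :
    Matrix (Fin (2 * k)) (Fin (2 * n)) (ZMod 2) :=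
  Matrix.of fun i j =>
    U ⟨2 * m + i.val, by have := i.isLt; omega⟩ ⟨j.val, by have := j.isLt; omega⟩

/-- The block Λ_M of a seed transformation: rows 2m+1..2m+2k, last 2m columns. -/
def lamM (n k m : ℕ) (hk : k ≤ n)
    (U : Matrix (Fin (2 * (n + m))) (Fin (2 * (n + m))) (ZMod 2)) :
    Matrix (Fin (2 * k)) (Fin (2 * m)) (ZMod 2) :=
  Matrix.of fun i j =>
    U ⟨2 * m + i.val, by have := i.isLt; omega⟩ ⟨2 * n + j.val, by have := j.isLt; omega⟩

/-- The block Σ_P of a seed transformation: rows of index 2m+2k+2i (1-indexed,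
i = 1,…,n−k), first 2n columns. -/
def sigP (n k m : ℕ)
    (U : Matrix (Fin (2 * (n + m))) (Fin (2 * (n + m))) (ZMod 2)) :
    Matrix (Fin (n - k)) (Fin (2 * n)) (ZMod 2) :=
  Matrix.of fun i j =>
    U ⟨2 * m + 2 * k + 2 * i.val + 1, by have := i.isLt; omega⟩
      ⟨j.val, by have := j.isLt; omega⟩

/-- The block Σ_M of a seed transformation: rows of index 2m+2k+2i (1-indexed,
i = 1,…,n−k), last 2m columns. -/
def sigM (n k m : ℕ)
    (U : Matrix (Fin (2 * (n + m))) (Fin (2 * (n + m))) (ZMod 2)) :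
    Matrix (Fin (n - k)) (Fin (2 * m)) (ZMod 2) :=
  Matrix.of fun i j =>
    U ⟨2 * m + 2 * k + 2 * i.val + 1, by have := i.isLt; omega⟩
      ⟨2 * n + j.val, by have := j.isLt; omega⟩


/-- (M:L:S) U_eff = (0_{2n} : M′): an edge of physical weight 0 (with syndrome input S)
from M to M′ with logical label L in the state diagram of the seed transformation U. -/
def ZeroPhysEdge (n k m : ℕ) (hk : k ≤ n)
    (U : Matrix (Fin (2 * (n + m))) (Fin (2 * (n + m))) (ZMod 2))
    (M : Fin (2 * m) → ZMod 2) (L : Fin (2 * k) → ZMod 2)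
    (S : Fin (n - k) → ZMod 2) (M' : Fin (2 * m) → ZMod 2) : Prop :=
  Matrix.vecMul M (muP n m U) + Matrix.vecMul L (lamP n k m hk U)
      + Matrix.vecMul S (sigP n k m U) = 0 ∧
  Matrix.vecMul M (muM n m U) + Matrix.vecMul L (lamM n k m hk U)
      + Matrix.vecMul S (sigM n k m U) = M'

/-- The orthogonal complement of a subspace W ⊆ F_2^{2m} under the symplectic product. -/
def sperp (m : ℕ) (W : Submodule (ZMod 2) (Fin (2 * m) → ZMod 2)) :
    Set (Fin (2 * m) → ZMod 2) :=
  {M | ∀ T ∈ W, sstar M T = 0}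

/-- The involution of the index set exchanging the two members of each pair `{2i, 2i+1}`. -/
def pairSwap {N : ℕ} (i : Fin (2 * N)) : Fin (2 * N) :=
  ⟨if i.val % 2 = 0 then i.val + 1 else i.val - 1, by have := i.isLt; split <;> omega⟩

lemma pairSwap_pairSwap {N : ℕ} (i : Fin (2 * N)) : pairSwap (pairSwap i) = i := by
  apply Fin.ext
  simp only [pairSwap]
  split_ifs <;> omega

lemma lambdaMat_apply {N : ℕ} (i j : Fin (2 * N)) :
    lambdaMat N i j = if i = pairSwap j then 1 else 0 := by
  simp only [lambdaMat, Matrix.of_apply, pairSwap]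
  refine if_congr ?_ rfl rfl
  rw [ne_eq, Fin.ext_iff, Fin.ext_iff]
  dsimp only
  split_ifs <;> omega

lemma vecMul_lambdaMat {N : ℕ} (P : Fin (2 * N) → ZMod 2) (i : Fin (2 * N)) :
    (P ᵥ* lambdaMat N) i = P (pairSwap i) := by
  simp [Matrix.vecMul, dotProduct, lambdaMat_apply]

lemma lambdaMat_mul_self (N : ℕ) : lambdaMat N * lambdaMat N = 1 := by
  ext i j
  simp [Matrix.mul_apply, lambdaMat_apply, Matrix.one_apply, pairSwap_pairSwap]

lemma sstar_eq_sum {N : ℕ} (P Q : Fin (2 * N) → ZMod 2) :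
    sstar P Q = ∑ i, P (pairSwap i) * Q i := by
  simp [sstar, dotProduct, vecMul_lambdaMat]

lemma sstar_single {N : ℕ} (P : Fin (2 * N) → ZMod 2) (i : Fin (2 * N)) :
    sstar P (Pi.single i 1) = P (pairSwap i) := by
  simp [sstar, vecMul_lambdaMat]

lemma IsSymplectic.sstar_vecMul {N : ℕ} {U : Matrix (Fin (2 * N)) (Fin (2 * N)) (ZMod 2)}
    (hU : IsSymplectic U) (P Q : Fin (2 * N) → ZMod 2) :
    sstar (P ᵥ* U) (Q ᵥ* U) = sstar P Q := by
  unfold sstar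
  rw [← Matrix.mulVec_transpose U Q, Matrix.dotProduct_mulVec, Matrix.vecMul_vecMul,
    Matrix.vecMul_vecMul, ← Matrix.mul_assoc, hU]

lemma IsSymplectic.isUnit {N : ℕ} {U : Matrix (Fin (2 * N)) (Fin (2 * N)) (ZMod 2)}
    (hU : IsSymplectic U) : IsUnit U := by
  refine IsUnit.of_mul_eq_one (lambdaMat N * Uᵀ * lambdaMat N) ?_
  rw [← Matrix.mul_assoc, ← Matrix.mul_assoc, hU, lambdaMat_mul_self]

lemma sum_fin_split {R : Type*} [AddCommMonoid R] {a b N : ℕ} (h : a + b = N) (f : Fin N → R) :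
    ∑ i, f i = ∑ i : Fin a, f ⟨i.val, by omega⟩ + ∑ i : Fin b, f ⟨a + i.val, by omega⟩ := by
  subst h
  exact Fin.sum_univ_add f

lemma sum_fin_two_mul {R : Type*} [AddCommMonoid R] {b : ℕ} (f : Fin (2 * b) → R) :
    ∑ i, f i = ∑ i : Fin b, f ⟨2 * i.val, by omega⟩ + ∑ i : Fin b, f ⟨2 * i.val + 1, by omega⟩ := by
  induction b with
  | zero => simp
  | succ b ih =>
    rw [sum_fin_split (show 2 * b + 2 = 2 * (b + 1) by ring), ih, Fin.sum_univ_two,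
      Fin.sum_univ_castSucc (n := b), Fin.sum_univ_castSucc (n := b)]
    exact add_add_add_comm _ _ _ _

/-- The product with a vector supported on the last `2m` coordinates. -/
lemma sstar_eq_of_left_supported {n m : ℕ} (P Q : Fin (2 * (n + m)) → ZMod 2)
    (hP : ∀ i, i.val < 2 * n → P i = 0) :
    sstar P Q = sstar (fun i : Fin (2 * m) => P ⟨2 * n + i.val, by omega⟩)
      (fun i : Fin (2 * m) => Q ⟨2 * n + i.val, by omega⟩) := by
  rw [sstar_eq_sum, sstar_eq_sum, sum_fin_split (show 2 * n + 2 * m = 2 * (n + m) by ring),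
    Finset.sum_eq_zero, zero_add]
  · refine Finset.sum_congr rfl fun i _ => ?_
    congr 2
    apply Fin.ext
    simp only [pairSwap]
    split_ifs <;> omega
  · intro i _
    rw [hP, zero_mul]
    simp only [pairSwap]
    split_ifs <;> omega

/-- The product with a vector supported on the first `2m` coordinates. -/
lemma sstar_eq_of_right_supported {n m : ℕ} (P Q : Fin (2 * (n + m)) → ZMod 2)
    (hQ : ∀ i, 2 * m ≤ i.val → Q i = 0) :
    sstar P Q = sstar (fun i : Fin (2 * m) => P ⟨i.val, by omega⟩)
      (fun i : Fin (2 * m) => Q ⟨i.val, by omega⟩) := by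
  rw [sstar_eq_sum, sstar_eq_sum, sum_fin_split (show 2 * m + 2 * n = 2 * (n + m) by ring),
    Finset.sum_eq_zero (s := (Finset.univ : Finset (Fin (2 * n)))), add_zero]
  · rfl
  · intro i _
    rw [hQ _ (Nat.le_add_right _ _), mul_zero]

/-- The vector `(0_{2n} : M')`. -/
def zeroPhys (n : ℕ) {m : ℕ} (M' : Fin (2 * m) → ZMod 2) : Fin (2 * (n + m)) → ZMod 2 :=
  fun j => if h : 2 * n ≤ j.val then M' ⟨j.val - 2 * n, by omega⟩ else 0

lemma sstar_zeroPhys (n : ℕ) {m : ℕ} (M' : Fin (2 * m) → ZMod 2)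
    (Q : Fin (2 * (n + m)) → ZMod 2) :
    sstar (zeroPhys n M') Q = sstar M' (fun i => Q ⟨2 * n + i.val, by omega⟩) := by
  rw [sstar_eq_of_left_supported _ _ fun i hi => by simp [zeroPhys, hi]]
  simp [zeroPhys]

lemma eq_zeroPhys_iff {n m : ℕ} (W : Fin (2 * (n + m)) → ZMod 2) (M' : Fin (2 * m) → ZMod 2) :
    W = zeroPhys n M' ↔ (∀ j : Fin (2 * n), W ⟨j.val, by omega⟩ = 0) ∧
      ∀ j : Fin (2 * m), W ⟨2 * n + j.val, by omega⟩ = M' j := by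
  constructor
  · rintro rfl
    refine ⟨fun j => ?_, fun j => ?_⟩ <;> simp [zeroPhys]
  · rintro ⟨h₁, h₂⟩
    ext j
    by_cases h : 2 * n ≤ j.val
    · rw [zeroPhys, dif_pos h, ← h₂]
      congr 1
      apply Fin.ext
      simp only
      omega
    · rw [zeroPhys, dif_neg h, ← h₁ ⟨j.val, by omega⟩]

/-- The sum over the rows of a seed transformation, split into the memory, logical and
syndrome rows, when the unused syndrome rows contribute nothing. -/
lemma sum_rows {n k m : ℕ} (hk : k ≤ n) (f : Fin (2 * (n + m)) → ZMod 2)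
    (hf : ∀ i : Fin (n - k), f ⟨2 * m + 2 * k + 2 * i.val, by omega⟩ = 0) :
    ∑ i, f i = ∑ i : Fin (2 * m), f ⟨i.val, by omega⟩
      + ∑ i : Fin (2 * k), f ⟨2 * m + i.val, by omega⟩
      + ∑ i : Fin (n - k), f ⟨2 * m + 2 * k + 2 * i.val + 1, by omega⟩ := by
  rw [sum_fin_split (show (2 * m + 2 * k) + 2 * (n - k) = 2 * (n + m) by omega),
    sum_fin_split (rfl : 2 * m + 2 * k = _), sum_fin_two_mul (b := n - k),
    Finset.sum_eq_zero (s := (Finset.univ : Finset (Fin (n - k)))) fun i _ => hf i, zero_add]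
  rfl

lemma zeroPhysEdge_iff {n k m : ℕ} (hk : k ≤ n)
    (U : Matrix (Fin (2 * (n + m))) (Fin (2 * (n + m))) (ZMod 2))
    (V : Fin (2 * (n + m)) → ZMod 2) (M' : Fin (2 * m) → ZMod 2)
    (hV : ∀ i : Fin (n - k), V ⟨2 * m + 2 * k + 2 * i.val, by omega⟩ = 0) :
    ZeroPhysEdge n k m hk U (fun i => V ⟨i.val, by omega⟩) (fun i => V ⟨2 * m + i.val, by omega⟩)
      (fun i => V ⟨2 * m + 2 * k + 2 * i.val + 1, by omega⟩) M' ↔ V ᵥ* U = zeroPhys n M' := by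
  have key : ∀ j, (V ᵥ* U) j = _ := fun j =>
    sum_rows hk (fun i => V i * U i j) fun i => by rw [hV, zero_mul]
  rw [eq_zeroPhys_iff, ZeroPhysEdge, funext_iff, funext_iff]
  simp only [key]
  rfl

/-- Every edge of physical weight 0 comes from a vector of the full input space. -/
lemma ZeroPhysEdge.exists_vecMul_eq {n k m : ℕ} {hk : k ≤ n}
    {U : Matrix (Fin (2 * (n + m))) (Fin (2 * (n + m))) (ZMod 2)}
    {M : Fin (2 * m) → ZMod 2} {L : Fin (2 * k) → ZMod 2} {S : Fin (n - k) → ZMod 2}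
    {M' : Fin (2 * m) → ZMod 2} (h : ZeroPhysEdge n k m hk U M L S M') :
    ∃ V : Fin (2 * (n + m)) → ZMod 2,
      (fun i : Fin (2 * m) => V ⟨i.val, by omega⟩) = M ∧ V ᵥ* U = zeroPhys n M' := by
  let V : Fin (2 * (n + m)) → ZMod 2 := fun j =>
    if h₁ : j.val < 2 * m then M ⟨j.val, h₁⟩
    else if h₂ : j.val < 2 * m + 2 * k then L ⟨j.val - 2 * m, by omega⟩
    else if j.val % 2 = 1 then S ⟨(j.val - 2 * m - 2 * k) / 2, by omega⟩ else 0
  have hM : (fun i : Fin (2 * m) => V ⟨i.val, by omega⟩) = M := by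
    ext i
    simp [V]
  have hL : (fun i : Fin (2 * k) => V ⟨2 * m + i.val, by omega⟩) = L := by
    ext i
    simp [V]
  have hS : (fun i : Fin (n - k) => V ⟨2 * m + 2 * k + 2 * i.val + 1, by omega⟩) = S := by
    ext i
    simp only [V]
    rw [dif_neg (by omega), dif_neg (by omega), if_pos (by omega)]
    congr 1
    apply Fin.ext
    simp only
    omega
  have hV : ∀ i : Fin (n - k), V ⟨2 * m + 2 * k + 2 * i.val, by omega⟩ = 0 := fun i => by
    simp only [V]
    rw [dif_neg (by omega), dif_neg (by omega), if_neg (by omega)]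
  refine ⟨V, hM, (zeroPhysEdge_iff hk U V M' hV).1 ?_⟩
  rwa [hM, hL, hS]

/-- If `V U = (0 : M')` then the memory part `M` of `V` satisfies `M ⋆ T = M' ⋆ T μ_M`. -/
lemma IsSymplectic.sstar_memory {n m : ℕ}
    {U : Matrix (Fin (2 * (n + m))) (Fin (2 * (n + m))) (ZMod 2)} (hU : IsSymplectic U)
    {V : Fin (2 * (n + m)) → ZMod 2} {M' : Fin (2 * m) → ZMod 2} (hV : V ᵥ* U = zeroPhys n M')
    (T : Fin (2 * m) → ZMod 2) :
    sstar (fun i : Fin (2 * m) => V ⟨i.val, by omega⟩) T = sstar M' (T ᵥ* muM n m U) := by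
  let T' : Fin (2 * (n + m)) → ZMod 2 := fun j => if h : j.val < 2 * m then T ⟨j.val, h⟩ else 0
  have hT' : ∀ i, 2 * m ≤ i.val → T' i = 0 := fun i hi => dif_neg (by omega)
  have hT : (fun i : Fin (2 * m) => T' ⟨i.val, by omega⟩) = T := by
    ext i
    simp [T']
  have h := sstar_eq_of_right_supported V T' hT'
  rw [hT, ← hU.sstar_vecMul, hV, sstar_zeroPhys] at h
  rw [← h]
  congr 1
  ext j
  simp only [Matrix.vecMul, dotProduct]
  rw [sum_fin_split (show 2 * m + 2 * n = 2 * (n + m) by ring),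
    Finset.sum_eq_zero (s := (Finset.univ : Finset (Fin (2 * n)))), add_zero]
  · refine Finset.sum_congr rfl fun i _ => ?_
    rw [← congrFun hT i]
    rfl
  · intro i _
    rw [hT' _ (Nat.le_add_right _ _), zero_mul]

lemma vecMul_mem_iSup_map_pow {ι : Type*} [Fintype ι] [DecidableEq ι] {R : Type*} [CommSemiring R]
    (A : Matrix ι ι R) (W : Submodule R (ι → R)) {T : ι → R}
    (hT : T ∈ ⨆ i : ℕ, W.map (A ^ i).vecMulLinear) :
    T ᵥ* A ∈ ⨆ i : ℕ, W.map (A ^ i).vecMulLinear := by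
  suffices h : (⨆ i : ℕ, W.map (A ^ i).vecMulLinear) ≤
      (⨆ i : ℕ, W.map (A ^ i).vecMulLinear).comap A.vecMulLinear from h hT
  refine iSup_le fun i => ?_
  rintro _ ⟨x, hx, rfl⟩
  refine Submodule.mem_iSup_of_mem (i + 1) ⟨x, hx, ?_⟩
  simp [pow_succ, Matrix.vecMul_vecMul]

/-- let 𝔰 be the row space of Σ_M and 𝔰₀ = Σ_{i≥0} 𝔰 μ_M^i the smallest
μ_M-invariant subspace containing 𝔰.  Then every M′ ∈ 𝔰₀^⊥ is the endpoint of an edge of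
physical weight 0 whose starting vertex M lies in 𝔰₀^⊥, and this M is unique. -/
theorem stmt_13 (n k m : ℕ) (hn : 1 ≤ n) (hk : k ≤ n) (hm : 1 ≤ m)
    (U : Matrix (Fin (2 * (n + m))) (Fin (2 * (n + m))) (ZMod 2))
    (hU : IsSymplectic U) :
    ∀ M' ∈ sperp m (⨆ i : ℕ, Submodule.map ((muM n m U) ^ i).vecMulLinear
        (Submodule.span (ZMod 2) (Set.range fun l => sigM n k m U l))),
      ∃! M : Fin (2 * m) → ZMod 2,
        M ∈ sperp m (⨆ i : ℕ, Submodule.map ((muM n m U) ^ i).vecMulLinear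
            (Submodule.span (ZMod 2) (Set.range fun l => sigM n k m U l))) ∧
        ∃ (L : Fin (2 * k) → ZMod 2) (S : Fin (n - k) → ZMod 2),
          ZeroPhysEdge n k m hk U M L S M' := by
  intro M' hM'
  obtain ⟨V, hV⟩ : ∃ V, V ᵥ* U = zeroPhys n M' :=
    Matrix.vecMul_surjective_iff_isUnit.2 hU.isUnit _
  refine ⟨fun i => V ⟨i.val, by omega⟩, ⟨fun T hT => ?_, _, _,
    (zeroPhysEdge_iff hk U V M' fun i => ?_).2 hV⟩, ?_⟩
  · rw [hU.sstar_memory hV]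
    exact hM' _ (vecMul_mem_iSup_map_pow _ _ hT)
  · have hi : 2 * m + 2 * k + 2 * i.val + 1 < 2 * (n + m) := by omega
    have h : sstar (V ᵥ* U) (U ⟨_, hi⟩) = 0 := by
      rw [hV, sstar_zeroPhys]
      refine hM' _ (Submodule.mem_iSup_of_mem 0 ⟨sigM n k m U i, ?_, ?_⟩)
      · exact Submodule.subset_span ⟨i, rfl⟩
      · rw [pow_zero, Matrix.vecMulLinear_apply, Matrix.vecMul_one]
        rfl
    have hrow : Pi.single ⟨_, hi⟩ 1 ᵥ* U = U ⟨_, hi⟩ := Matrix.single_one_vecMul _ _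
    rw [← hrow, hU.sstar_vecMul, sstar_single] at h
    rw [← h]
    congr 1
    apply Fin.ext
    simp only [pairSwap]
    split_ifs <;> omega
  · rintro M ⟨-, L, S, hE⟩
    obtain ⟨V', rfl, hV'⟩ := hE.exists_vecMul_eq
    rw [Matrix.vecMul_injective_of_isUnit hU.isUnit (hV'.trans hV.symm)]
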